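/- Let 𝒜 be an abelian category, ℰ a full additive subcategory, and 𝒯 an ℰ-preresolving subcategory of 𝒜 admitting an ℰ-proper generator 𝒞, with 𝒯 ⊆ 𝒞^⊥ ∩ ^⊥𝒞 and 𝒞 closed under direct summands. Then for an object A of 𝒜, 𝒯-dim A = 𝒞-dim A provided one of the following holds: (1) 𝒞-dim A < ∞, ℰ = 𝒞, and 𝒯 is closed under kernels of 𝒞-proper epimorphisms; (2) 𝒞-dim A < ∞, ℰ = 𝒞, and the class of objects of finite 𝒞-dimension is closed under direct summands; (3) A is an object in 𝒯^⊥ and 𝒞 is a cogenerator for 𝒯. -/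

import Mathlib

open CategoryTheory CategoryTheory.Limits CategoryTheory.Abelian ZeroObject

universe w v u

namespace RelHomDim

variable {𝒜 : Type u} [Category.{v} 𝒜] [Abelian 𝒜]

/-- A class of objects of an abelian category corresponding to a full additive
subcategory: it is closed under isomorphisms, contains a zero object and is
closed under finite direct sums (biproducts). -/
def IsAdditiveClass (P : 𝒜 → Prop) : Prop :=
  P 0 ∧ (∀ ⦃X Y : 𝒜⦄, (X ≅ Y) → P X → P Y) ∧ ∀ ⦃X Y : 𝒜⦄, P X → P Y → P (X ⊞ Y)

/-- A class of objects is closed under direct summands. -/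
def ClosedUnderSummands (P : 𝒜 → Prop) : Prop :=
  ∀ X Y : 𝒜, P (X ⊞ Y) → P X ∧ P Y

/-- `Hom(W,-)`-exactness of a short exact sequence `0 → X₁ → X₂ → X₃ → 0`:
the induced sequence `0 → Hom(W,X₁) → Hom(W,X₂) → Hom(W,X₃) → 0` is exact. -/
def CovHomExact (W : 𝒜) (S : ShortComplex 𝒜) : Prop :=
  (∀ a b : W ⟶ S.X₁, a ≫ S.f = b ≫ S.f → a = b) ∧
  (∀ b : W ⟶ S.X₂, b ≫ S.g = 0 → ∃ a : W ⟶ S.X₁, a ≫ S.f = b) ∧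
  (∀ c : W ⟶ S.X₃, ∃ b : W ⟶ S.X₂, b ≫ S.g = c)

/-- A short exact sequence is `ℰ`-proper (i.e. `Hom(ℰ,-)`-exact) if it is
`Hom(E,-)`-exact for every object `E` in the class `ℰ`. -/
def EProper (E : 𝒜 → Prop) (S : ShortComplex 𝒜) : Prop :=
  ∀ W, E W → CovHomExact W S

/-- `ResW P W n K A` holds iff there is an exact sequence
`0 → K → X_{n-1} → ⋯ → X_0 → A → 0` in `𝒜` with all the `n` middle terms `X i`
in `P`, such that each of the short exact sequences obtained by splicing
satisfies `W` (this encodes, e.g., `Hom(ℰ,-)`-exactness of the whole sequence). -/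
def ResW (P : 𝒜 → Prop) (W : ShortComplex 𝒜 → Prop) : ℕ → 𝒜 → 𝒜 → Prop
  | 0 => fun K A => Nonempty (K ≅ A)
  | n + 1 => fun K A => ∃ (B X : 𝒜) (f : B ⟶ X) (g : X ⟶ A) (w : f ≫ g = 0),
      P X ∧ (ShortComplex.mk f g w).ShortExact ∧ W (ShortComplex.mk f g w) ∧
      ResW P W n K B

/-- `Res P n K A` : there is an exact sequence `0 → K → X_{n-1} → ⋯ → X_0 → A → 0`
with all middle terms in `P`. -/
abbrev Res (P : 𝒜 → Prop) : ℕ → 𝒜 → 𝒜 → Prop := ResW P fun _ => True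

/-- `CoresW P W n A K` holds iff there is an exact sequence
`0 → A → X^0 → ⋯ → X^{n-1} → K → 0` with all middle terms in `P` and each
spliced short exact piece satisfying `W`. -/
def CoresW (P : 𝒜 → Prop) (W : ShortComplex 𝒜 → Prop) : ℕ → 𝒜 → 𝒜 → Prop
  | 0 => fun A K => Nonempty (A ≅ K)
  | n + 1 => fun A K => ∃ (X B : 𝒜) (f : A ⟶ X) (g : X ⟶ B) (w : f ≫ g = 0),
      P X ∧ (ShortComplex.mk f g w).ShortExact ∧ W (ShortComplex.mk f g w) ∧
      CoresW P W n B K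

/-- `Cores P n A K` : there is an exact sequence `0 → A → X^0 → ⋯ → X^{n-1} → K → 0`
with all middle terms in `P`. -/
abbrev Cores (P : 𝒜 → Prop) : ℕ → 𝒜 → 𝒜 → Prop := CoresW P fun _ => True

/-- The `P`-dimension of `A` : the infimum of the `n ≥ 0` such that there is
an exact sequence `0 → C_n → ⋯ → C_1 → C_0 → A → 0` with all `C_i` in `P`
(`⊤ = ∞` if there is no such `n`). -/
noncomputable def rdim (P : 𝒜 → Prop) (A : 𝒜) : ℕ∞ :=
  sInf {c : ℕ∞ | ∃ n : ℕ, c = n ∧ ∃ K, P K ∧ Res P n K A}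

/-- The `P`-codimension of `A` : the infimum of the `n ≥ 0` such that there is
an exact sequence `0 → A → C^0 → C^1 → ⋯ → C^n → 0` with all `C^i` in `P`
(`⊤ = ∞` if there is no such `n`). -/
noncomputable def rcodim (P : 𝒜 → Prop) (A : 𝒜) : ℕ∞ :=
  sInf {c : ℕ∞ | ∃ n : ℕ, c = n ∧ ∃ K, P K ∧ Cores P n A K}

/-- `A` belongs to `P^⊥`, i.e. `Ext^i(C, A) = 0` for all `C` in `P` and `i ≥ 1`. -/
def MemRightPerp [HasExt.{w} 𝒜] (P : 𝒜 → Prop) (A : 𝒜) : Prop :=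
  ∀ C, P C → ∀ i : ℕ, 1 ≤ i → Subsingleton (Abelian.Ext C A i)

/-- `A` belongs to `^⊥P`, i.e. `Ext^i(A, C) = 0` for all `C` in `P` and `i ≥ 1`. -/
def MemLeftPerp [HasExt.{w} 𝒜] (P : 𝒜 → Prop) (A : 𝒜) : Prop :=
  ∀ C, P C → ∀ i : ℕ, 1 ≤ i → Subsingleton (Abelian.Ext A C i)

/-- `𝒞` is an `ℰ`-proper generator for `𝒯` (`𝒞 ⊆ 𝒯` and every object of `𝒯`
is an `ℰ`-proper quotient of an object of `𝒞` with kernel in `𝒯`). -/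
def IsProperGenerator (E C T : 𝒜 → Prop) : Prop :=
  (∀ ⦃X⦄, C X → T X) ∧
  ∀ X, T X → ∃ (X' Cb : 𝒜) (f : X' ⟶ Cb) (g : Cb ⟶ X) (w : f ≫ g = 0),
    C Cb ∧ T X' ∧ (ShortComplex.mk f g w).ShortExact ∧ EProper E (ShortComplex.mk f g w)

/-- `𝒞` is a cogenerator for `𝒯`. -/
def IsCogenerator (C T : 𝒜 → Prop) : Prop :=
  (∀ ⦃X⦄, C X → T X) ∧
  ∀ X, T X → ∃ (Cb X' : 𝒜) (f : X ⟶ Cb) (g : Cb ⟶ X') (w : f ≫ g = 0),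
    C Cb ∧ T X' ∧ (ShortComplex.mk f g w).ShortExact

/-- `𝒯` is closed under `ℰ`-proper extensions. -/
def ClosedUnderProperExtensions (E T : 𝒜 → Prop) : Prop :=
  ∀ S : ShortComplex 𝒜, S.ShortExact → EProper E S → T S.X₁ → T S.X₃ → T S.X₂

/-- `𝒯` is closed under kernels of `ℰ`-proper epimorphisms. -/
def ClosedUnderProperKernels (E T : 𝒜 → Prop) : Prop :=
  ∀ S : ShortComplex 𝒜, S.ShortExact → EProper E S → T S.X₂ → T S.X₃ → T S.X₁

/-- `𝒯` is an `ℰ`-preresolving subcategory with `ℰ`-proper generator `𝒞`. -/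
def IsPreresolving (E T C : 𝒜 → Prop) : Prop :=
  IsProperGenerator E C T ∧ ClosedUnderProperExtensions E T


/-- Exactness of a four-term sequence `0 → M → T₁ → T₀ → A → 0`. -/
def FourTermExact {M T1 T0 A : 𝒜} (f : M ⟶ T1) (g : T1 ⟶ T0) (h : T0 ⟶ A) : Prop :=
  Mono f ∧ Epi h ∧ ∃ (w₁ : f ≫ g = 0) (w₂ : g ≫ h = 0),
    (ShortComplex.mk f g w₁).Exact ∧ (ShortComplex.mk g h w₂).Exact

/-- `Hom(W,-)`-exactness of the four-term exact sequence `0 → M → T₁ → T₀ → A → 0` :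
the induced sequence `0 → Hom(W,M) → Hom(W,T₁) → Hom(W,T₀) → Hom(W,A) → 0` is exact. -/
def CovHomExact4 (W : 𝒜) {M T1 T0 A : 𝒜} (f : M ⟶ T1) (g : T1 ⟶ T0) (h : T0 ⟶ A) : Prop :=
  (∀ a b : W ⟶ M, a ≫ f = b ≫ f → a = b) ∧
  (∀ b : W ⟶ T1, b ≫ g = 0 → ∃ a : W ⟶ M, a ≫ f = b) ∧
  (∀ c : W ⟶ T0, c ≫ h = 0 → ∃ b : W ⟶ T1, b ≫ g = c) ∧
  (∀ d : W ⟶ A, ∃ c : W ⟶ T0, c ≫ h = d)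

/-- There is an exact sequence `0 → M → K⁰ → C¹ → ⋯ → Cⁿ → 0` with `K⁰` in `T`
and all `C^i` in `C`. -/
def MixedCores (T C : 𝒜 → Prop) : ℕ → 𝒜 → Prop
  | 0 => fun M => ∃ K, T K ∧ Nonempty (M ≅ K)
  | n + 1 => fun M => ∃ (K H : 𝒜) (f : M ⟶ K) (g : K ⟶ H) (w : f ≫ g = 0),
      T K ∧ (ShortComplex.mk f g w).ShortExact ∧ ∃ K', C K' ∧ Cores C n H K'

/-- The Gorenstein subcategory `𝒢(𝒞)` : objects `A` admitting a doubly infinite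
exact sequence `⋯ → X_{-1} → X_0 → X_1 → ⋯` with all terms in `𝒞`, which is both
`Hom(𝒞,-)`-exact and `Hom(-,𝒞)`-exact, such that `A ≅ Im(X_0 → X_1)`. -/
def IsGorenstein (P : 𝒜 → Prop) (A : 𝒜) : Prop :=
  ∃ (X : ℤ → 𝒜) (d : ∀ i : ℤ, X i ⟶ X (i + 1)) (w : ∀ i, d i ≫ d (i + 1) = 0),
    (∀ i, P (X i)) ∧
    (∀ i, (ShortComplex.mk (d i) (d (i + 1)) (w i)).Exact) ∧
    (∀ C, P C → ∀ (i : ℤ) (f : C ⟶ X (i + 1)), f ≫ d (i + 1) = 0 →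
      ∃ g : C ⟶ X i, g ≫ d i = f) ∧
    (∀ C, P C → ∀ (i : ℤ) (f : X (i + 1) ⟶ C), d i ≫ f = 0 →
      ∃ g : X (i + 1 + 1) ⟶ C, d (i + 1) ≫ g = f) ∧
    Nonempty (A ≅ Limits.image (d 0))

end RelHomDim

namespace RelHomDim

section Auxiliary

variable {𝒜 : Type u} [Category.{v} 𝒜] [Abelian 𝒜]

theorem exists_shortExact_of_isPullback {X₁ X₂ X₃ Y P : 𝒜} {f : X₁ ⟶ X₂} {g : X₂ ⟶ X₃}
    {w : f ≫ g = 0} (hS : (ShortComplex.mk f g w).ShortExact) {h : Y ⟶ X₃} {p : P ⟶ X₂}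
    {q : P ⟶ Y} (sq : IsPullback p q g h) :
    ∃ (f' : X₁ ⟶ P) (w' : f' ≫ q = 0), (ShortComplex.mk f' q w').ShortExact ∧
      ∀ E : 𝒜 → Prop, EProper E (ShortComplex.mk f g w) →
        EProper E (ShortComplex.mk f' q w') := by
  have : Mono f := hS.mono_f
  have : Epi g := hS.epi_g
  have hf' : sq.lift f 0 (by simp [w]) ≫ p = f := by simp
  have w' : sq.lift f 0 (by simp [w]) ≫ q = 0 := by simp
  generalize sq.lift f 0 (by simp [w]) = f' at hf' w'
  have : Mono (f' ≫ p) := by rw [hf']; infer_instance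
  have : Mono f' := mono_of_mono f' p
  have : Epi q := (MorphismProperty.epimorphisms 𝒜).of_isPullback sq
    (inferInstanceAs (Epi g))
  have key : ∀ {W : 𝒜} (b : W ⟶ P), b ≫ q = 0 → ∃ a : W ⟶ X₁, a ≫ f' = b := by
    intro W b hb
    have hb' : (b ≫ p) ≫ g = 0 := by rw [Category.assoc, sq.w, reassoc_of% hb, zero_comp]
    refine ⟨hS.exact.lift (b ≫ p) hb', sq.hom_ext ?_ ?_⟩
    · rw [Category.assoc, hf']
      exact hS.exact.lift_f _ _
    · rw [Category.assoc, w', comp_zero, hb]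
  refine ⟨f', w', ShortComplex.ShortExact.mk' ?_ ‹_› ‹_›, fun E hE W hW => ⟨?_, ?_, ?_⟩⟩
  · rw [ShortComplex.exact_iff_exact_up_to_refinements]
    intro W b hb
    obtain ⟨a, ha⟩ := key b hb
    exact ⟨W, 𝟙 W, inferInstance, a, by simp [ha]⟩
  · exact fun a b hab => (cancel_mono f').1 hab
  · exact fun b hb => key b hb
  · intro c
    obtain ⟨b, hb⟩ := (hE W hW).2.2 (c ≫ h)
    exact ⟨sq.lift b c hb, by simp⟩

theorem shortExact_comp_of_isPullback {B X A Z P : 𝒜} {f : B ⟶ X} {g : X ⟶ A}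
    {w : f ≫ g = 0} (hS : (ShortComplex.mk f g w).ShortExact) {e : Z ⟶ X} [Epi e] {p : P ⟶ Z}
    {q : P ⟶ B} (sq : IsPullback p q e f) :
    ∃ w' : p ≫ e ≫ g = 0, (ShortComplex.mk p (e ≫ g) w').ShortExact := by
  have : Mono f := hS.mono_f
  have : Epi g := hS.epi_g
  have w' : p ≫ e ≫ g = 0 := by rw [sq.w_assoc, w, comp_zero]
  have : Mono p := (MorphismProperty.monomorphisms 𝒜).of_isPullback sq.flip
    (inferInstanceAs (Mono f))
  refine ⟨w', ShortComplex.ShortExact.mk' ?_ ‹_› (epi_comp e g)⟩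
  rw [ShortComplex.exact_iff_exact_up_to_refinements]
  intro W b hb
  have hb' : (b ≫ e) ≫ g = 0 := by simpa using hb
  exact ⟨W, 𝟙 W, inferInstance, sq.lift b (hS.exact.lift (b ≫ e) hb')
    (hS.exact.lift_f _ _).symm, by simp⟩

theorem exists_shortExact_of_isPushout {X Y Z W P : 𝒜} {t : X ⟶ Y} {g : Y ⟶ Z}
    {w : t ≫ g = 0} (hS : (ShortComplex.mk t g w).ShortExact) {l : X ⟶ W} {r : Y ⟶ P}
    {b : W ⟶ P} (sq : IsPushout t l r b) :
    ∃ (g' : P ⟶ Z) (w' : b ≫ g' = 0), (ShortComplex.mk b g' w').ShortExact := by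
  have : Mono t := hS.mono_f
  have : Epi g := hS.epi_g
  have hg' : r ≫ sq.desc g 0 (by simp [w]) = g := by simp
  have w' : b ≫ sq.desc g 0 (by simp [w]) = 0 := by simp
  generalize sq.desc g 0 (by simp [w]) = g' at hg' w'
  have : Epi (r ≫ g') := by rw [hg']; infer_instance
  have : Epi g' := epi_of_epi r g'
  have : Mono b := (MorphismProperty.monomorphisms 𝒜).of_isPushout sq.flip
    (inferInstanceAs (Mono t))
  refine ⟨g', w', ShortComplex.ShortExact.mk' (ShortComplex.exact_of_g_is_cokernel _
    (CokernelCofork.IsColimit.ofπ' _ _ fun {V} k hk => ?_)) ‹_› ‹_›⟩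
  have hk' : t ≫ r ≫ k = 0 := by
    dsimp at hk
    rw [sq.w_assoc, hk, comp_zero]
  have hd : g ≫ hS.exact.desc (r ≫ k) hk' = r ≫ k := hS.exact.g_desc _ _
  refine ⟨hS.exact.desc (r ≫ k) hk', sq.hom_ext ?_ ?_⟩
  · dsimp
    rw [reassoc_of% hg', hd]
  · dsimp at hk ⊢
    rw [reassoc_of% w', zero_comp, hk]

theorem shortExact_comp_of_isPushout {K X W Y P : 𝒜} {k : K ⟶ X} {l : X ⟶ W}
    {w : k ≫ l = 0} (hS : (ShortComplex.mk k l w).ShortExact) {t : X ⟶ Y} [Mono t] {r : Y ⟶ P}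
    {b : W ⟶ P} (sq : IsPushout t l r b) :
    ∃ w' : (k ≫ t) ≫ r = 0, (ShortComplex.mk (k ≫ t) r w').ShortExact := by
  have : Mono k := hS.mono_f
  have : Epi l := hS.epi_g
  have w' : (k ≫ t) ≫ r = 0 := by rw [Category.assoc, sq.w, reassoc_of% w, zero_comp]
  have : Epi r := (MorphismProperty.epimorphisms 𝒜).of_isPushout sq
    (inferInstanceAs (Epi l))
  refine ⟨w', ShortComplex.ShortExact.mk' (ShortComplex.exact_of_g_is_cokernel _
    (CokernelCofork.IsColimit.ofπ' _ _ fun {V} m hm => ?_)) (mono_comp k t) ‹_›⟩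
  have hm' : k ≫ t ≫ m = 0 := by simpa using hm
  exact ⟨sq.desc m (hS.exact.desc (t ≫ m) hm') (hS.exact.g_desc _ _).symm, by simp⟩

theorem ResW.mono {P Q : 𝒜 → Prop} (h : ∀ ⦃X⦄, P X → Q X) {W : ShortComplex 𝒜 → Prop} :
    ∀ {n : ℕ} {K A : 𝒜}, ResW P W n K A → ResW Q W n K A
  | 0, _, _, hA => hA
  | _ + 1, _, _, ⟨B, X, f, g, w, hX, hS, hW, hB⟩ => ⟨B, X, f, g, w, h hX, hS, hW, hB.mono h⟩

theorem rdim_anti {P Q : 𝒜 → Prop} (h : ∀ ⦃X⦄, P X → Q X) (A : 𝒜) : rdim Q A ≤ rdim P A := by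
  refine sInf_le_sInf ?_
  rintro c ⟨n, hc, K, hK, hR⟩
  exact ⟨n, hc, K, h hK, ResW.mono h hR⟩

/-- If `X` is a proper extension of `K` by an object of `T`, then a `T`-resolution of `K`
gives a `T`-resolution of `X` of the same length. -/
theorem exists_res_of_proper_extension {E T : 𝒜 → Prop} (hT : IsAdditiveClass T)
    (hext : ClosedUnderProperExtensions E T) {T' X K : 𝒜} {f : T' ⟶ X} {g : X ⟶ K}
    {w : f ≫ g = 0} (hS : (ShortComplex.mk f g w).ShortExact)
    (hE : EProper E (ShortComplex.mk f g w)) (hT' : T T') {n : ℕ} {L : 𝒜} (hL : T L)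
    (hR : Res T n L K) : ∃ L', T L' ∧ Res T n L' X := by
  cases n with
  | zero =>
    obtain ⟨e⟩ := hR
    exact ⟨X, hext _ hS hE hT' (hT.2.1 e hL), ⟨Iso.refl _⟩⟩
  | succ n =>
    obtain ⟨B, T₁, i, p, wip, hT₁, hip, -, hB⟩ := hR
    have sq := IsPullback.of_hasPullback g p
    obtain ⟨_, _, h₁, hE₁⟩ := exists_shortExact_of_isPullback hS sq
    obtain ⟨i', w', h₂, -⟩ := exists_shortExact_of_isPullback hip sq.flip
    exact ⟨L, hL, B, _, i', _, w', hext _ h₁ (hE₁ E hE) hT' hT₁, h₂, trivial, hB⟩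

/-- A `T`-resolution can be replaced by one of the same length in which all terms but
the last one belong to a proper generator of `T`. -/
theorem exists_res_of_isPreresolving {E T C : 𝒜 → Prop} (hT : IsAdditiveClass T)
    (hpre : IsPreresolving E T C) {n : ℕ} : ∀ {L A : 𝒜}, T L → Res T n L A →
      ∃ L', T L' ∧ Res C n L' A := by
  induction n with
  | zero => exact fun hL hR => ⟨_, hL, hR⟩
  | succ n ih =>
    rintro L A hL ⟨B, T₀, f, g, w, hT₀, hS, -, hB⟩
    obtain ⟨T', Z, i, e, wie, hZ, hT', hie, hE⟩ := hpre.1.2 T₀ hT₀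
    have : Epi e := hie.epi_g
    have sq := IsPullback.of_hasPullback e f
    obtain ⟨_, _, h₁, hE₁⟩ := exists_shortExact_of_isPullback hie sq
    obtain ⟨w', h₂⟩ := shortExact_comp_of_isPullback hS sq
    obtain ⟨L₁, hL₁, hR₁⟩ := exists_res_of_proper_extension hT hpre.2 h₁ (hE₁ E hE) hT' hL hB
    obtain ⟨L₂, hL₂, hR₂⟩ := ih hL₁ hR₁
    exact ⟨L₂, hL₂, _, Z, _, _, w', hZ, h₂, trivial, hR₂⟩

theorem of_splitting_X₂ {P : 𝒜 → Prop} (hP : IsAdditiveClass P) {S : ShortComplex 𝒜}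
    (s : S.Splitting) (h₁ : P S.X₁) (h₃ : P S.X₃) : P S.X₂ :=
  hP.2.1 s.isoBinaryBiproduct.symm (hP.2.2 h₁ h₃)

theorem of_splitting_X₁_X₃ {P : 𝒜 → Prop} (hP : IsAdditiveClass P)
    (hsum : ClosedUnderSummands P) {S : ShortComplex 𝒜} (s : S.Splitting) (h : P S.X₂) :
    P S.X₁ ∧ P S.X₃ :=
  hsum _ _ (hP.2.1 s.isoBinaryBiproduct h)

variable [HasExt.{w} 𝒜]

theorem subsingleton_ext_X₃ {S : ShortComplex 𝒜} (hS : S.ShortExact) (Y : 𝒜) (n : ℕ)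
    (h₁ : Subsingleton (Ext S.X₁ Y n)) (h₂ : Subsingleton (Ext S.X₂ Y (n + 1))) :
    Subsingleton (Ext S.X₃ Y (n + 1)) := by
  refine subsingleton_of_forall_eq 0 fun x => ?_
  obtain ⟨y, rfl⟩ := Ext.contravariant_sequence_exact₃ hS Y x (Subsingleton.elim _ _)
    (add_comm 1 n)
  rw [Subsingleton.elim y 0, Ext.comp_zero]

theorem subsingleton_ext_X₁ {S : ShortComplex 𝒜} (hS : S.ShortExact) (Y : 𝒜) (n : ℕ)
    (h₂ : Subsingleton (Ext S.X₂ Y n)) (h₃ : Subsingleton (Ext S.X₃ Y (n + 1))) :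
    Subsingleton (Ext S.X₁ Y n) := by
  refine subsingleton_of_forall_eq 0 fun x => ?_
  obtain ⟨y, rfl⟩ := Ext.contravariant_sequence_exact₁ hS Y x (add_comm 1 n)
    (Subsingleton.elim _ _)
  rw [Subsingleton.elim y 0, Ext.comp_zero]

theorem subsingleton_ext_of_retract {X Y : 𝒜} (r : Retract X Y) (Z : 𝒜) (n : ℕ)
    (h : Subsingleton (Ext Y Z n)) : Subsingleton (Ext X Z n) := by
  refine subsingleton_of_forall_eq 0 fun x => ?_
  rw [← Ext.mk₀_id_comp x, ← r.retract, ← Ext.mk₀_comp_mk₀_assoc,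
    Subsingleton.elim ((Ext.mk₀ r.r).comp x (zero_add n)) 0, Ext.comp_zero]

theorem nonempty_splitting_of_subsingleton_ext {S : ShortComplex 𝒜} (hS : S.ShortExact)
    (h : Subsingleton (Ext S.X₃ S.X₁ 1)) : Nonempty S.Splitting := by
  have : Mono S.f := hS.mono_f
  obtain ⟨x, hx⟩ := Ext.covariant_sequence_exact₃ S.X₃ hS (Ext.mk₀ (𝟙 S.X₃)) (zero_add 1)
    (Subsingleton.elim _ _)
  obtain ⟨s, rfl⟩ := Ext.addEquiv₀.symm.surjective x
  refine ⟨ShortComplex.Splitting.ofExactOfSection S hS.exact s ?_ ‹_›⟩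
  apply (Ext.mk₀_bijective S.X₃ S.X₃).1
  simpa using hx

theorem subsingleton_ext_of_iso {X Y : 𝒜} (e : X ≅ Y) (Z : 𝒜) (n : ℕ)
    (h : Subsingleton (Ext Y Z n)) : Subsingleton (Ext X Z n) :=
  subsingleton_ext_of_retract (Retract.ofIso e) Z n h

theorem subsingleton_ext_of_res {C : 𝒜 → Prop} {Y : 𝒜} (hY : MemRightPerp.{w} C Y) {i : ℕ} :
    ∀ {n : ℕ} {K A : 𝒜}, Res C n K A → Subsingleton (Ext.{w} K Y (i + 1)) →
      Subsingleton (Ext.{w} A Y (n + i + 1))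
  | 0, _, _, ⟨e⟩, h => by
    rw [zero_add]
    exact subsingleton_ext_of_iso e.symm Y _ h
  | n + 1, _, _, ⟨_, X, _, _, _, hX, hS, _, hB⟩, h => by
    have := subsingleton_ext_X₃ hS Y (n + i + 1) (subsingleton_ext_of_res hY hB h)
      (hY X hX _ (by lia))
    rwa [show n + 1 + i + 1 = n + i + 1 + 1 by lia]

theorem subsingleton_ext_syzygy_of_res {C : 𝒜 → Prop} {Y : 𝒜} (hY : MemRightPerp.{w} C Y)
    {i : ℕ} : ∀ {n : ℕ} {K A : 𝒜}, Res C n K A → Subsingleton (Ext.{w} A Y (n + i + 1)) →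
      Subsingleton (Ext.{w} K Y (i + 1))
  | 0, _, _, ⟨e⟩, h => by
    rw [zero_add] at h
    exact subsingleton_ext_of_iso e Y _ h
  | n + 1, _, _, ⟨_, X, _, _, _, hX, hS, _, hB⟩, h => by
    rw [show n + 1 + i + 1 = n + i + 1 + 1 by lia] at h
    exact subsingleton_ext_syzygy_of_res hY hB
      (subsingleton_ext_X₁ hS Y (n + i + 1) (hY X hX _ (by lia)) h)

/-- An object of `T` of finite relative projective dimension with respect to `T` belongs
to the generator `C`. -/
theorem mem_generator_of_subsingleton_ext {E T C : 𝒜 → Prop} (hC : IsAdditiveClass C)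
    (hCsum : ClosedUnderSummands C) (hgen : IsProperGenerator E C T)
    (hsub : ∀ X : 𝒜, T X → MemRightPerp.{w} C X ∧ MemLeftPerp.{w} C X) {j : ℕ} :
    ∀ {K : 𝒜}, T K → (∀ Y, T Y → Subsingleton (Ext.{w} K Y (j + 1))) → C K := by
  induction j with
  | zero =>
    intro K hK h
    obtain ⟨X, Z, f, g, w, hZ, hX, hS, -⟩ := hgen.2 K hK
    obtain ⟨s⟩ := nonempty_splitting_of_subsingleton_ext hS (h X hX)
    exact (of_splitting_X₁_X₃ hC hCsum s hZ).2
  | succ j ih =>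
    intro K hK h
    obtain ⟨X, Z, f, g, w, hZ, hX, hS, -⟩ := hgen.2 K hK
    have hCX : C X := ih hX fun Y hY =>
      subsingleton_ext_X₁ hS Y (j + 1) ((hsub Y hY).1 Z hZ _ (by lia)) (h Y hY)
    obtain ⟨s⟩ := nonempty_splitting_of_subsingleton_ext hS ((hsub K hK).2 X hCX 1 le_rfl)
    exact (of_splitting_X₁_X₃ hC hCsum s hZ).2

/-- Auslander–Buchweitz type embedding of an object of finite `T`-dimension into an object
of finite relative projective dimension, with cokernel in `T`. -/
theorem exists_shortExact_of_isCogenerator {T C : 𝒜 → Prop} (hT : IsAdditiveClass T)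
    (hcog : IsCogenerator C T)
    (hsub : ∀ X : 𝒜, T X → MemRightPerp.{w} C X ∧ MemLeftPerp.{w} C X) {n : ℕ} :
    ∀ {L A : 𝒜}, T L → Res C n L A →
      ∃ (H T' : 𝒜) (f : A ⟶ H) (g : H ⟶ T') (w : f ≫ g = 0), T T' ∧
        (ShortComplex.mk f g w).ShortExact ∧
        ∀ Y, T Y → Subsingleton (Ext.{w} H Y (n + 1)) := by
  induction n with
  | zero =>
    rintro L A hL ⟨e⟩
    obtain ⟨Z, T', f, g, w, hZ, hT', hS⟩ := hcog.2 A (hT.2.1 e hL)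
    exact ⟨Z, T', f, g, w, hT', hS, fun Y hY => (hsub Y hY).1 Z hZ _ (by lia)⟩
  | succ n ih =>
    rintro L A hL ⟨B, X, f, g, w, hX, hS, -, hB⟩
    obtain ⟨H', T', f', g', w', hT', hS', hH'⟩ := ih hL hB
    have sq := IsPushout.of_hasPushout f f'
    obtain ⟨a, wa, ha⟩ := exists_shortExact_of_isPushout hS sq
    obtain ⟨c, wc, hc⟩ := exists_shortExact_of_isPushout hS' sq.flip
    obtain ⟨s⟩ := nonempty_splitting_of_subsingleton_ext hc ((hsub T' hT').2 X hX 1 le_rfl)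
    obtain ⟨Z, T'', u, v, wuv, hZ, hT'', huv⟩ :=
      hcog.2 _ (of_splitting_X₂ hT s (hcog.1 hX) hT')
    have : Mono u := huv.mono_f
    have sq' := IsPushout.of_hasPushout u a
    obtain ⟨v', wv', hv'⟩ := exists_shortExact_of_isPushout huv sq'
    obtain ⟨_, hH⟩ := shortExact_comp_of_isPushout ha sq'
    exact ⟨_, T'', _, v', wv', hT'', hv', fun Y hY =>
      subsingleton_ext_X₃ hH Y (n + 1) (hH' Y hY) ((hsub Y hY).1 Z hZ _ (by lia))⟩

end Auxiliary

end RelHomDim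

open RelHomDim in
/-- Theorem 3.10. -/
theorem stmt12 {𝒜 : Type u} [Category.{v} 𝒜] [Abelian 𝒜] [HasExt.{w} 𝒜]
    (ℰ 𝒯 𝒞 : 𝒜 → Prop) (hℰ : IsAdditiveClass ℰ) (h𝒯 : IsAdditiveClass 𝒯)
    (h𝒞 : IsAdditiveClass 𝒞) (hpre : IsPreresolving ℰ 𝒯 𝒞)
    (hsub : ∀ X : 𝒜, 𝒯 X → MemRightPerp 𝒞 X ∧ MemLeftPerp 𝒞 X)
    (hCsum : ClosedUnderSummands 𝒞) (A : 𝒜)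
    (hcase :
      (rdim 𝒞 A < ⊤ ∧ ℰ = 𝒞 ∧ ClosedUnderProperKernels 𝒞 𝒯) ∨
      (rdim 𝒞 A < ⊤ ∧ ℰ = 𝒞 ∧ ClosedUnderSummands (fun X : 𝒜 => rdim 𝒞 X < ⊤)) ∨
      (MemRightPerp 𝒯 A ∧ IsCogenerator 𝒞 𝒯)) :
    rdim 𝒯 A = rdim 𝒞 A := by
  refine le_antisymm (rdim_anti hpre.1.1 A) (le_sInf ?_)
  rintro c ⟨n, rfl, L₀, hL₀, hR₀⟩
  obtain ⟨L, hL, hR⟩ := exists_res_of_isPreresolving h𝒯 hpre hL₀ hR₀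
  suffices hvan : ∃ j, ∀ Y, 𝒯 Y → Subsingleton (Ext.{w} A Y (n + j + 1)) by
    obtain ⟨j, hj⟩ := hvan
    exact sInf_le ⟨n, rfl, L, mem_generator_of_subsingleton_ext h𝒞 hCsum hpre.1 hsub hL
      fun Y hY => subsingleton_ext_syzygy_of_res (hsub Y hY).1 hR (hj Y hY), hR⟩
  have hfin : rdim 𝒞 A < ⊤ → ∃ j, ∀ Y, 𝒯 Y → Subsingleton (Ext.{w} A Y (n + j + 1)) := by
    intro h
    obtain ⟨-, ⟨m, rfl, K, hK, hRK⟩, -⟩ := sInf_lt_iff.1 h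
    refine ⟨m, fun Y hY => ?_⟩
    rw [add_comm n m]
    exact subsingleton_ext_of_res (hsub Y hY).1 hRK ((hsub Y hY).1 K hK _ (by lia))
  rcases hcase with ⟨h, -, -⟩ | ⟨h, -, -⟩ | ⟨hA, hcog⟩
  · exact hfin h
  · exact hfin h
  · obtain ⟨H, T', f, g, w, hT', hS, hH⟩ :=
      exists_shortExact_of_isCogenerator h𝒯 hcog hsub hL hR
    obtain ⟨s⟩ := nonempty_splitting_of_subsingleton_ext hS (hA T' hT' 1 le_rfl)
    exact ⟨0, fun Y hY => subsingleton_ext_of_retract ⟨f, s.r, s.f_r⟩ Y _ (hH Y hY)⟩
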